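/- For every integer k ≥ 1 and every real number q with 0 < q < 2k/(3k+1), there is no universal voting rule that satisfies both the second-order positional dominance criterion and the (q,k)-majority criterion. -/

import Mathlib

open Finset
open scoped Classical

noncomputable section

/-- A preference profile: each of the `n` voters has a ranking of the `m`
candidates, given as a bijection sending each candidate to its rank
(rank `0` is the best).  Voter `i` prefers `a` to `b` iff `P i a < P i b`. -/
abbrev Profile (m n : ℕ) := Fin n → (Fin m ≃ Fin m)

namespace Voting

variable {m n : ℕ}

/-- `h(a,b)`: the number of voters who prefer candidate `a` to candidate `b`. -/
def pairs (P : Profile m n) (a b : Fin m) : ℕ :=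
  (Finset.univ.filter fun i => P i a < P i b).card

/-- `n_1(a)`: the number of voters who rank candidate `a` first. -/
def firstCount (P : Profile m n) (a : Fin m) : ℕ :=
  (Finset.univ.filter fun i => ∀ b, b ≠ a → P i a < P i b).card

/-- `n_m(a)`: the number of voters who rank candidate `a` last. -/
def lastCount (P : Profile m n) (a : Fin m) : ℕ :=
  (Finset.univ.filter fun i => ∀ b, b ≠ a → P i b < P i a).card

/-- The number of voters who give the set `B` the top `|B|` positions. -/
def topSupporters (P : Profile m n) (B : Finset (Fin m)) : ℕ :=
  (Finset.univ.filter fun i => ∀ a ∈ B, ∀ b ∉ B, P i a < P i b).card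

/-- The `(q,k,m)`-majority criterion for a voting rule with `m` candidates:
for every number of voters `n ≥ 1`, every profile, and every `k`-element set `B`
of candidates such that strictly more than `q·n` voters give `B` the top `k`
positions, every winner belongs to `B`. -/
def MajorityCriterion (m k : ℕ) (q : ℝ)
    (rule : (n : ℕ) → Profile m n → Finset (Fin m)) : Prop :=
  ∀ n : ℕ, 1 ≤ n → ∀ P : Profile m n, ∀ B : Finset (Fin m),
    B.card = k → q * (n : ℝ) < (topSupporters P B : ℝ) → rule n P ⊆ B

/-- The total score of candidate `a` under the scoring vector `s`
(`s j` is the score for rank `j`). -/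
def totalScore (P : Profile m n) (s : Fin m → ℝ) (a : Fin m) : ℝ :=
  ∑ i, s (P i a)

/-- The scoring rule with scores `s`: winners have the highest total score. -/
def scoringWinners (P : Profile m n) (s : Fin m → ℝ) : Finset (Fin m) :=
  Finset.univ.filter fun a => ∀ b, totalScore P s b ≤ totalScore P s a

/-- A voting rule defined for every number of candidates and voters. -/
abbrev Rule := (m n : ℕ) → Profile m n → Finset (Fin m)

/-- A universal voting rule returns a nonempty choice set on every problem. -/
def Universal (C : Rule) : Prop :=
  ∀ m n : ℕ, 1 ≤ m → 1 ≤ n → ∀ P : Profile m n, (C m n P).Nonempty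

/-- A convex scoring vector: the differences of consecutive scores are positive
and nondecreasing from the bottom position to the top:
`0 < s_{m−1} − s_m ≤ s_{m−2} − s_{m−1} ≤ … ≤ s_1 − s_2`. -/
def ConvexScores {m : ℕ} (s : Fin m → ℝ) : Prop :=
  (∀ (j : ℕ) (h : j + 1 < m), 0 < s ⟨j, by omega⟩ - s ⟨j + 1, h⟩) ∧
  (∀ (j : ℕ) (h : j + 2 < m),
    s ⟨j + 1, by omega⟩ - s ⟨j + 2, h⟩ ≤ s ⟨j, by omega⟩ - s ⟨j + 1, by omega⟩)

/-- The second-order positional dominance (2-PD) criterion: whenever `a` gets a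
strictly higher total score than `b` under every convex scoring rule, `b` is
not a winner. -/
def SecondOrderPD (C : Rule) : Prop :=
  ∀ (m n : ℕ) (P : Profile m n) (a b : Fin m),
    (∀ s : Fin m → ℝ, ConvexScores s → totalScore P s b < totalScore P s a) →
    b ∉ C m n P

/-- The `(q,k)`-majority criterion for a universal rule: the `(q,k,m)`-majority
criterion holds for every total number of candidates `m > k`. -/
def RuleMajority (C : Rule) (q : ℝ) (k : ℕ) : Prop :=
  ∀ m : ℕ, k < m → ∀ n : ℕ, 1 ≤ n → ∀ P : Profile m n, ∀ B : Finset (Fin m),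
    B.card = k → q * (n : ℝ) < (topSupporters P B : ℝ) → C m n P ⊆ B

/-- A convex sequence stays below its chord: the last step times the number of
steps is at most the total drop. -/
lemma mul_last_step_le_drop (f : ℕ → ℝ) (k : ℕ)
    (hf : ∀ j < k, f (j + 1) - f (j + 2) ≤ f j - f (j + 1)) :
    (k : ℝ) * (f k - f (k + 1)) ≤ f 0 - f k := by
  induction k with
  | zero => simp
  | succ k ih =>
    have h1 := ih fun j hj => hf j (by omega)
    have h2 := mul_le_mul_of_nonneg_left (hf k (by omega)) (by positivity : (0 : ℝ) ≤ k + 1)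
    push_cast
    linarith

/-- For a convex sequence, the average of `f r - f k` over `r < k` is at most
`(k + 1) / (2k)` times the drop `f 0 - f k`. -/
lemma two_mul_sum_sub_le (f : ℕ → ℝ) (k : ℕ)
    (hf : ∀ j, j + 2 ≤ k → f (j + 1) - f (j + 2) ≤ f j - f (j + 1)) :
    2 * ((∑ r ∈ Finset.range k, f r) - k * f k) ≤ (k + 1) * (f 0 - f k) := by
  induction k with
  | zero => simp
  | succ k ih =>
    have h1 := ih fun j hj => hf j (by omega)
    have h2 := mul_last_step_le_drop f k fun j hj => hf j (by omega)
    rw [Finset.sum_range_succ]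
    push_cast
    linarith

lemma ConvexScores.lt {s : Fin m → ℝ} (hs : ConvexScores s) {a b : Fin m} (h : a < b) :
    s b < s a := by
  obtain ⟨a, ha⟩ := a
  obtain ⟨b, hb⟩ := b
  have hab : a + 1 ≤ b := h
  clear h
  induction b, hab using Nat.le_induction with
  | base => linarith [hs.1 a hb]
  | succ b hab ih => linarith [hs.1 b hb, ih (by omega)]

lemma ConvexScores.two_mul_sum_sub_le {k : ℕ} {s : Fin m → ℝ} (hs : ConvexScores s)
    (hk : k < m) :
    2 * ((∑ r : Fin k, s ⟨r, r.2.trans hk⟩) - k * s ⟨k, hk⟩) ≤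
      (k + 1) * (s ⟨0, by omega⟩ - s ⟨k, hk⟩) := by
  have h := Voting.two_mul_sum_sub_le (fun j => if h : j < m then s ⟨j, h⟩ else 0) k (by
    intro j hj
    simpa [show j < m by omega, show j + 1 < m by omega, show j + 2 < m by omega]
      using hs.2 j (by omega))
  rw [← Fin.sum_univ_eq_sum_range] at h
  simpa [hk, show 0 < m by omega, fun r : Fin k => r.2.trans hk] using h

/-- The ranking that cyclically shifts the first `k` candidates by `j` and fixes the others. -/
def shiftRanking (k : ℕ) [NeZero k] (j : Fin k) : Fin (k + k) ≃ Fin (k + k) :=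
  finSumFinEquiv.symm.trans
    ((Equiv.sumCongr (Equiv.addLeft j) (Equiv.refl _)).trans finSumFinEquiv)

/-- The ranking that exchanges the first `k` candidates with the last `k`. -/
def swapRanking (k : ℕ) : Fin (k + k) ≃ Fin (k + k) :=
  finSumFinEquiv.symm.trans ((Equiv.sumComm _ _).trans finSumFinEquiv)

lemma shiftRanking_castAdd (k : ℕ) [NeZero k] (j i : Fin k) :
    shiftRanking k j (Fin.castAdd k i) = Fin.castAdd k (j + i) := by
  simp [shiftRanking]

lemma shiftRanking_natAdd (k : ℕ) [NeZero k] (j i : Fin k) :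
    shiftRanking k j (Fin.natAdd k i) = Fin.natAdd k i := by
  simp [shiftRanking, -Fin.natAdd_eq_addNat]

lemma swapRanking_castAdd (k : ℕ) (i : Fin k) :
    swapRanking k (Fin.castAdd k i) = Fin.natAdd k i := by
  simp [swapRanking]

lemma swapRanking_natAdd (k : ℕ) (i : Fin k) :
    swapRanking k (Fin.natAdd k i) = Fin.castAdd k i := by
  simp [swapRanking, -Fin.natAdd_eq_addNat]

/-- The identification of voters with `t` blocks of `k` voters followed by `u` more voters. -/
def voterEquiv (t k u : ℕ) : Fin (t * k + u) ≃ (Fin t × Fin k) ⊕ Fin u :=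
  finSumFinEquiv.symm.trans (Equiv.sumCongr finProdFinEquiv.symm (Equiv.refl _))

/-- The profile in which each cyclic shift of the first `k` candidates is used by `t` voters,
and `u` voters put the first `k` candidates at the bottom. -/
def cyclicProfile (t k u : ℕ) [NeZero k] : Profile (k + k) (t * k + u) := fun i =>
  Sum.elim (fun x => shiftRanking k x.2) (fun _ => swapRanking k) (voterEquiv t k u i)

lemma totalScore_cyclicProfile (t k u : ℕ) [NeZero k] (s : Fin (k + k) → ℝ)
    (a : Fin (k + k)) :
    totalScore (cyclicProfile t k u) s a =
      t * ∑ j, s (shiftRanking k j a) + u * s (swapRanking k a) := by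
  unfold totalScore cyclicProfile
  rw [(voterEquiv t k u).sum_comp
    (fun x => s (Sum.elim (fun x => shiftRanking k x.2) (fun _ => swapRanking k) x a))]
  simp [Fintype.sum_sum_type, Fintype.sum_prod_type]

/-- The set of the first `k` candidates. -/
def firstHalf (k : ℕ) : Finset (Fin (k + k)) :=
  Finset.univ.map (Fin.castAddEmb k)

lemma card_firstHalf (k : ℕ) : (firstHalf k).card = k := by
  simp [firstHalf]

lemma le_topSupporters_cyclicProfile (t k u : ℕ) [NeZero k] :
    t * k ≤ topSupporters (cyclicProfile t k u) (firstHalf k) := by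
  have h := Finset.card_le_card_of_injOn (s := (Finset.univ : Finset (Fin t × Fin k)))
    (t := Finset.univ.filter fun i => ∀ a ∈ firstHalf k, ∀ b ∉ firstHalf k,
      cyclicProfile t k u i a < cyclicProfile t k u i b)
    (fun x => (voterEquiv t k u).symm (Sum.inl x)) ?_ ?_
  · simpa [topSupporters] using h
  · intro x _
    simp only [Finset.coe_filter, Finset.mem_univ, true_and, Set.mem_ofPred_eq]
    intro a ha b hb
    obtain ⟨i, rfl⟩ : ∃ i, Fin.castAdd k i = a := by simpa [firstHalf] using ha
    induction b using Fin.addCases with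
    | left j => exact absurd (by simp [firstHalf]) hb
    | right j =>
      simp only [cyclicProfile, Equiv.apply_symm_apply, Sum.elim_inl, shiftRanking_castAdd,
        shiftRanking_natAdd]
      exact Fin.lt_def.2 ((x.2 + i).2.trans_le (Nat.le_add_right k j))
  · intro x _ y _ hxy
    simpa using hxy

/-- If the voters against the first half are numerous enough, then candidate `k` dominates
every candidate in the first half. -/
lemma totalScore_cyclicProfile_lt (t k u : ℕ) [NeZero k] (htu : t * (k + 1) < 2 * u)
    {s : Fin (k + k) → ℝ} (hs : ConvexScores s) (i : Fin k) :
    totalScore (cyclicProfile t k u) s (Fin.castAdd k i) <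
      totalScore (cyclicProfile t k u) s (Fin.natAdd k 0) := by
  have hk : 0 < k := Nat.pos_of_neZero k
  have hsum : ∑ j : Fin k, s (Fin.castAdd k (j + i)) = ∑ r : Fin k, s (Fin.castAdd k r) :=
    Equiv.sum_comp (Equiv.addRight i) fun r => s (Fin.castAdd k r)
  simp only [totalScore_cyclicProfile, shiftRanking_castAdd, shiftRanking_natAdd,
    swapRanking_castAdd, swapRanking_natAdd, hsum, Finset.sum_const, Finset.card_univ,
    Fintype.card_fin, nsmul_eq_mul]
  have hconv : 2 * ((∑ r : Fin k, s (Fin.castAdd k r)) - k * s (Fin.natAdd k 0)) ≤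
      (k + 1) * (s (Fin.castAdd k 0) - s (Fin.natAdd k 0)) :=
    hs.two_mul_sum_sub_le (k := k) (by omega)
  have hdrop : s (Fin.natAdd k 0) < s (Fin.castAdd k 0) :=
    hs.lt (Fin.lt_def.2 (by simpa using hk))
  have hbot : s (Fin.natAdd k i) ≤ s (Fin.natAdd k 0) := by
    rcases eq_or_lt_of_le (Fin.zero_le i) with h | h
    · rw [← h]
    · exact (hs.lt ((Fin.natAdd_lt_natAdd_iff k).2 h)).le
  have htu' : (t : ℝ) * (k + 1) < 2 * u := by exact_mod_cast htu
  have h1 := mul_le_mul_of_nonneg_left hconv (Nat.cast_nonneg (α := ℝ) t)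
  have h2 := mul_lt_mul_of_pos_right htu' (sub_pos.2 hdrop)
  have h3 := mul_le_mul_of_nonneg_left hbot (Nat.cast_nonneg (α := ℝ) u)
  linarith

/-- For every integer `k ≥ 1` and every real `q` with `0 < q < 2k/(3k+1)`,
no universal voting rule satisfies both the second-order positional dominance
criterion and the `(q,k)`-majority criterion. -/
theorem no_2PD_and_qk_majority (k : ℕ) (hk : 1 ≤ k) (q : ℝ) (hq0 : 0 < q)
    (hq : q < 2 * (k : ℝ) / (3 * (k : ℝ) + 1)) :
    ¬ ∃ C : Rule, Universal C ∧ SecondOrderPD C ∧ RuleMajority C q k := by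
  rintro ⟨C, hU, hPD, hM⟩
  have : NeZero k := ⟨by omega⟩
  have hgap : 0 < 2 * (k : ℝ) - q * (3 * k + 1) := by
    rw [lt_div_iff₀ (by positivity)] at hq
    linarith
  obtain ⟨T, hT⟩ := exists_nat_gt (q / (2 * (k : ℝ) - q * (3 * k + 1)))
  rw [div_lt_iff₀ hgap] at hT
  obtain ⟨t, ht⟩ : ∃ t, t = 2 * T := ⟨_, rfl⟩
  obtain ⟨u, hu⟩ : ∃ u, u = T * (k + 1) + 1 := ⟨_, rfl⟩
  have hsub : C (k + k) (t * k + u) (cyclicProfile t k u) ⊆ firstHalf k := by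
    refine hM _ (by omega) _ (by omega) _ _ (card_firstHalf k) ?_
    refine lt_of_lt_of_le ?_ (Nat.cast_le.2 (le_topSupporters_cyclicProfile t k u))
    subst ht hu
    push_cast
    linarith
  obtain ⟨a, ha⟩ := hU (k + k) (t * k + u) (by omega) (by omega) (cyclicProfile t k u)
  obtain ⟨i, rfl⟩ : ∃ i, Fin.castAdd k i = a := by simpa [firstHalf] using hsub ha
  refine hPD _ _ _ (Fin.natAdd k 0) _ (fun s hs => ?_) ha
  refine totalScore_cyclicProfile_lt t k u ?_ hs i
  subst ht hu
  linarith

end Voting
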